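/- Fix θ > 0 and an integer ℓ ≥ 1, and let C_ℓ be the constant from the main cumulant bound. Then for every N ≥ 1 and all lists i_1, …, i_ℓ and s_1, …, s_ℓ of integers in [N], if σ is an Ewens(θ)-distributed random permutation of S_N, then |κ( B^{(N)}_{i_1,s_1}, …, B^{(N)}_{i_ℓ,s_ℓ} )| ≤ C_ℓ · N^{−t+1}, where t = |{i_1, …, i_ℓ, s_1, …, s_ℓ}| is the number of distinct values appearing among all the i_j and s_j. In particular, there exists a constant depending only on ℓ and θ for which this bound holds. -/

import Mathlib

open scoped BigOperators Classical
open Finset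

noncomputable section

/-- Total number of cycles of a permutation of `Fin N`, fixed points included. -/
def cycleCount {N : ℕ} (σ : Equiv.Perm (Fin N)) : ℕ :=
  Multiset.card σ.cycleType + (N - σ.cycleType.sum)

/-- Expectation of `f` under the Ewens measure with parameter `θ` on `S_N`. -/
def ewensE (θ : ℝ) (N : ℕ) (f : Equiv.Perm (Fin N) → ℝ) : ℝ :=
  (∑ σ : Equiv.Perm (Fin N), θ ^ cycleCount σ * f σ) / ∏ k ∈ Finset.range N, (θ + (k : ℝ))

/-- Probability of an event under the Ewens measure. -/
def ewensP (θ : ℝ) (N : ℕ) (A : Set (Equiv.Perm (Fin N))) : ℝ :=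
  ewensE θ N (fun σ => if σ ∈ A then 1 else 0)

/-- The Bernoulli random variable `B^{(N)}_{i,s}`, equal to 1 iff `σ i = s`. -/
def Bis {N : ℕ} (i s : Fin N) (σ : Equiv.Perm (Fin N)) : ℝ :=
  if σ i = s then 1 else 0

/-- The set partitions of a finset `S`, encoded as finsets of nonempty disjoint finsets
covering `S`. -/
def partitionsOf {ι : Type*} [DecidableEq ι] (S : Finset ι) : Finset (Finset (Finset ι)) :=
  S.powerset.powerset.filter
    (fun P => (∀ C ∈ P, C.Nonempty) ∧ ∀ j ∈ S, ∃! C, C ∈ P ∧ j ∈ C)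

/-- The joint cumulant of the family of random variables indexed by `S`, expressed through
the moments function `M` : `κ = Σ_π (−1)^{#π−1} (#π−1)! Π_{C ∈ π} M C`. -/
def cumulantOn {ι 𝕜 : Type*} [DecidableEq ι] [Field 𝕜] (S : Finset ι) (M : Finset ι → 𝕜) : 𝕜 :=
  ∑ P ∈ partitionsOf S,
    (-1 : 𝕜) ^ (P.card - 1) * ((P.card - 1).factorial : 𝕜) * ∏ C ∈ P, M C

/-! ### Cycle counts -/

/-- The orbit of `x` under the permutation `σ`, as a finset. -/
def orbitFinset {N : ℕ} (σ : Equiv.Perm (Fin N)) (x : Fin N) : Finset (Fin N) :=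
  univ.filter fun y => σ.SameCycle x y

lemma mem_orbitFinset {N : ℕ} {σ : Equiv.Perm (Fin N)} {x y : Fin N} :
    y ∈ orbitFinset σ x ↔ σ.SameCycle x y := by
  simp [orbitFinset]

lemma orbitFinset_eq_iff {N : ℕ} {σ : Equiv.Perm (Fin N)} {x y : Fin N} :
    orbitFinset σ x = orbitFinset σ y ↔ σ.SameCycle x y := by
  constructor
  · intro h
    have : y ∈ orbitFinset σ y := mem_orbitFinset.2 (Equiv.Perm.SameCycle.refl _ _)
    rw [← h] at this
    exact mem_orbitFinset.1 this
  · intro h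
    ext z
    simp only [mem_orbitFinset]
    exact ⟨fun hz => h.symm.trans hz, fun hz => h.trans hz⟩

lemma cycleCount_eq_card_orbits {N : ℕ} (σ : Equiv.Perm (Fin N)) :
    cycleCount σ = (univ.image (orbitFinset σ)).card := by
  have hsplit : (univ : Finset (Fin N)) = σ.support ∪ σ.supportᶜ := by simp
  have himg : σ.support.image (orbitFinset σ) = σ.cycleFactorsFinset.image Equiv.Perm.support := by
    have hsupp : ∀ x ∈ σ.support, orbitFinset σ x = (σ.cycleOf x).support := by
      intro x hx
      ext y
      rw [mem_orbitFinset, Equiv.Perm.mem_support_cycleOf_iff]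
      simp [hx]
    ext O
    simp only [mem_image]
    constructor
    · rintro ⟨x, hx, rfl⟩
      exact ⟨σ.cycleOf x, Equiv.Perm.cycleOf_mem_cycleFactorsFinset_iff.2 hx, (hsupp x hx).symm⟩
    · rintro ⟨c, hc, rfl⟩
      obtain ⟨x, hx⟩ := (Equiv.Perm.mem_cycleFactorsFinset_iff.1 hc).1.nonempty_support
      refine ⟨x, Equiv.Perm.mem_cycleFactorsFinset_support_le hc hx, ?_⟩
      rw [hsupp x (Equiv.Perm.mem_cycleFactorsFinset_support_le hc hx),
        ← Equiv.Perm.cycle_is_cycleOf hx hc]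
  have hcard₁ : (σ.support.image (orbitFinset σ)).card = Multiset.card σ.cycleType := by
    rw [himg, Equiv.Perm.cycleType_def, Multiset.card_map, Finset.card_val,
      Finset.card_image_of_injOn]
    intro c hc d hd hcd
    by_contra hne
    have hdis := Equiv.Perm.cycleFactorsFinset_pairwise_disjoint σ hc hd hne
    rw [Equiv.Perm.disjoint_iff_disjoint_support] at hdis
    have hcd : c.support = d.support := hcd
    rw [hcd, Finset.disjoint_self_iff_empty] at hdis
    have := (Equiv.Perm.mem_cycleFactorsFinset_iff.1 (Finset.mem_coe.1 hd)).1.nonempty_support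
    rw [hdis] at this
    exact Finset.not_nonempty_empty this
  have hfix : ∀ x ∈ σ.supportᶜ, ∀ y, σ.SameCycle x y → x = y := by
    intro x hx y hxy
    have hx' : Function.IsFixedPt σ x := by
      rw [Function.IsFixedPt]
      simpa using hx
    exact hxy.eq_of_left hx'
  have hcard₂ : (σ.supportᶜ.image (orbitFinset σ)).card = N - σ.cycleType.sum := by
    rw [Finset.card_image_of_injOn, Finset.card_compl, Equiv.Perm.sum_cycleType, Fintype.card_fin]
    intro x hx y _ hxy
    exact hfix x (Finset.mem_coe.1 hx) y (orbitFinset_eq_iff.1 hxy)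
  rw [hsplit, Finset.image_union, Finset.card_union_of_disjoint, hcard₁, hcard₂, cycleCount]
  rw [Finset.disjoint_left]
  intro O hO hO'
  obtain ⟨x, hx, rfl⟩ := mem_image.1 hO
  obtain ⟨y, hy, hyx⟩ := mem_image.1 hO'
  have := hfix y hy x (orbitFinset_eq_iff.1 hyx)
  subst this
  exact (Finset.mem_compl.1 hy) hx

lemma sameCycle_mul_swap_iff {N : ℕ} {σ : Equiv.Perm (Fin N)} {a b : Fin N}
    (hab : ¬ σ.SameCycle a b) (x y : Fin N) :
    (σ * Equiv.swap a b).SameCycle x y ↔ σ.SameCycle x y ∨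
      ((σ.SameCycle a x ∨ σ.SameCycle b x) ∧ (σ.SameCycle a y ∨ σ.SameCycle b y)) := by
  set τ := σ * Equiv.swap a b with hτ
  have hτa : τ a = σ b := by simp [hτ]
  have hτb : τ b = σ a := by simp [hτ]
  have hτx : ∀ z, z ≠ a → z ≠ b → τ z = σ z := fun z h₁ h₂ => by
    simp [hτ, Equiv.swap_apply_of_ne_of_ne h₁ h₂]
  have hne : a ≠ b := fun h => hab (h ▸ Equiv.Perm.SameCycle.refl _ _)
  constructor
  · have key : ∀ n : ℕ, σ.SameCycle x ((τ ^ n) x) ∨ ((σ.SameCycle a x ∨ σ.SameCycle b x) ∧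
        (σ.SameCycle a ((τ ^ n) x) ∨ σ.SameCycle b ((τ ^ n) x))) := by
      intro n
      induction n with
      | zero => exact Or.inl (Equiv.Perm.SameCycle.refl _ _)
      | succ n ih =>
        rw [pow_succ', Equiv.Perm.mul_apply]
        generalize (τ ^ n) x = z at ih
        by_cases hza : z = a
        · subst hza
          rw [hτa]
          right
          refine ⟨?_, Or.inr (Equiv.Perm.sameCycle_apply_right.2 (Equiv.Perm.SameCycle.refl _ _))⟩
          rcases ih with h | h
          · exact Or.inl h.symm
          · exact h.1
        by_cases hzb : z = b
        · subst hzb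
          rw [hτb]
          right
          refine ⟨?_, Or.inl (Equiv.Perm.sameCycle_apply_right.2 (Equiv.Perm.SameCycle.refl _ _))⟩
          rcases ih with h | h
          · exact Or.inr h.symm
          · exact h.1
        · rw [hτx z hza hzb]
          simpa only [Equiv.Perm.sameCycle_apply_right] using ih
    intro h
    obtain ⟨n, -, hn⟩ := h.exists_pow_eq'
    simpa only [hn] using key n
  · have hreach : ∀ c d : Fin N, τ d = σ c → (∀ z, z ≠ c → σ.SameCycle c z → τ z = σ z) →
        ∀ n : ℕ, τ.SameCycle d ((σ ^ (n + 1)) c) := by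
      intro c d hd hz n
      induction n with
      | zero =>
        rw [zero_add, pow_one, ← hd]
        exact Equiv.Perm.sameCycle_apply_right.2 (Equiv.Perm.SameCycle.refl _ _)
      | succ n ih =>
        rw [pow_succ', Equiv.Perm.mul_apply]
        by_cases hc : (σ ^ (n + 1)) c = c
        · rw [hc, ← hd]
          exact Equiv.Perm.sameCycle_apply_right.2 (Equiv.Perm.SameCycle.refl _ _)
        · rw [← hz _ hc ⟨((n + 1 : ℕ) : ℤ), by rw [zpow_natCast]⟩]
          exact Equiv.Perm.sameCycle_apply_right.2 ih
    have hba : τ.SameCycle b a := by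
      have := hreach a b hτb (fun z hz hz' => hτx z hz fun h => hab (h ▸ hz'))
        (orderOf σ - 1)
      rwa [Nat.sub_add_cancel (orderOf_pos σ), pow_orderOf_eq_one] at this
    have hstep : ∀ z, τ.SameCycle z (σ z) := by
      intro z
      by_cases hza : z = a
      · subst hza
        rw [← hτb]
        exact Equiv.Perm.sameCycle_apply_right.2 hba.symm
      by_cases hzb : z = b
      · subst hzb
        rw [← hτa]
        exact Equiv.Perm.sameCycle_apply_right.2 hba
      · rw [← hτx z hza hzb]
        exact Equiv.Perm.sameCycle_apply_right.2 (Equiv.Perm.SameCycle.refl _ _)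
    have hle : ∀ u v, σ.SameCycle u v → τ.SameCycle u v := by
      intro u v h
      obtain ⟨n, -, hn⟩ := h.exists_pow_eq'
      rw [← hn]
      clear hn
      induction n with
      | zero => exact Equiv.Perm.SameCycle.refl _ _
      | succ n ih =>
        rw [pow_succ', Equiv.Perm.mul_apply]
        exact ih.trans (hstep _)
    rintro (h | ⟨h₁ | h₁, h₂ | h₂⟩)
    · exact hle _ _ h
    · exact (hle _ _ h₁).symm.trans (hle _ _ h₂)
    · exact (hle _ _ h₁).symm.trans (hba.symm.trans (hle _ _ h₂))
    · exact (hle _ _ h₁).symm.trans (hba.trans (hle _ _ h₂))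
    · exact (hle _ _ h₁).symm.trans (hle _ _ h₂)

lemma cycleCount_mul_swap {N : ℕ} {σ : Equiv.Perm (Fin N)} {a b : Fin N}
    (hab : ¬ σ.SameCycle a b) :
    cycleCount (σ * Equiv.swap a b) + 1 = cycleCount σ := by
  rw [cycleCount_eq_card_orbits, cycleCount_eq_card_orbits]
  set τ := σ * Equiv.swap a b with hτ
  set U := orbitFinset σ a ∪ orbitFinset σ b with hU
  have hrefl : ∀ z, σ.SameCycle z z := fun z => Equiv.Perm.SameCycle.refl _ _
  have horb : ∀ x, orbitFinset τ x = if x ∈ U then U else orbitFinset σ x := by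
    intro x
    ext y
    have := sameCycle_mul_swap_iff hab x y
    split_ifs with hx
    · simp only [hU, mem_union, mem_orbitFinset] at hx ⊢
      rw [this]
      constructor
      · rintro (h | h)
        · exact hx.imp (fun h' => h'.trans h) (fun h' => h'.trans h)
        · exact h.2
      · exact fun h => Or.inr ⟨hx, h⟩
    · simp only [hU, mem_union, mem_orbitFinset] at hx ⊢
      rw [this]
      tauto
  have hoab : orbitFinset σ a ≠ orbitFinset σ b := fun h => hab (orbitFinset_eq_iff.1 h)
  have himg : univ.image (orbitFinset τ) =
      insert U (((univ.image (orbitFinset σ)).erase (orbitFinset σ a)).erase (orbitFinset σ b)) := by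
    ext O
    simp only [mem_image, mem_insert, mem_erase, mem_univ, true_and]
    constructor
    · rintro ⟨x, rfl⟩
      rw [horb]
      split_ifs with hx
      · exact Or.inl rfl
      · simp only [hU, mem_union, mem_orbitFinset, not_or] at hx
        refine Or.inr ⟨fun h => hx.2 (orbitFinset_eq_iff.1 h).symm,
          fun h => hx.1 (orbitFinset_eq_iff.1 h).symm, x, rfl⟩
    · rintro (rfl | ⟨h₁, h₂, x, rfl⟩)
      · refine ⟨a, ?_⟩
        rw [horb, if_pos]
        exact mem_union_left _ (mem_orbitFinset.2 (hrefl a))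
      · refine ⟨x, ?_⟩
        rw [horb, if_neg]
        simp only [hU, mem_union, mem_orbitFinset, not_or]
        exact ⟨fun h => h₂ (orbitFinset_eq_iff.2 h.symm), fun h => h₁ (orbitFinset_eq_iff.2 h.symm)⟩
  have hUnot : U ∉ ((univ.image (orbitFinset σ)).erase (orbitFinset σ a)).erase
      (orbitFinset σ b) := by
    intro h
    obtain ⟨x, -, hx⟩ := mem_image.1 (mem_of_mem_erase (mem_of_mem_erase h))
    have ha : a ∈ orbitFinset σ x := hx ▸ mem_union_left _ (mem_orbitFinset.2 (hrefl a))
    have hb : b ∈ orbitFinset σ x := hx ▸ mem_union_right _ (mem_orbitFinset.2 (hrefl b))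
    exact hab ((mem_orbitFinset.1 ha).symm.trans (mem_orbitFinset.1 hb))
  have hma : orbitFinset σ a ∈ univ.image (orbitFinset σ) := mem_image_of_mem _ (mem_univ _)
  have hmb : orbitFinset σ b ∈ (univ.image (orbitFinset σ)).erase (orbitFinset σ a) :=
    mem_erase.2 ⟨hoab.symm, mem_image_of_mem _ (mem_univ _)⟩
  have h₁ := card_erase_add_one hma
  have h₂ := card_erase_add_one hmb
  rw [himg, card_insert_of_notMem hUnot]
  omega

lemma cycleCount_one (N : ℕ) : cycleCount (1 : Equiv.Perm (Fin N)) = N := by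
  simp [cycleCount]

lemma cycleCount_mul_of_disjoint {N : ℕ} {σ τ : Equiv.Perm (Fin N)}
    (h : Equiv.Perm.Disjoint σ τ) :
    cycleCount (σ * τ) + N = cycleCount σ + cycleCount τ := by
  have h₁ := (σ * τ).sum_cycleType_le
  have h₂ := h.cycleType_mul
  rw [Fintype.card_fin] at h₁
  unfold cycleCount
  rw [h₂] at h₁ ⊢
  rw [Multiset.sum_add] at h₁ ⊢
  rw [Multiset.card_add]
  omega

/-! ### Partial permutations and their closures -/

/-- The vertices covered by a finite set of directed edges. -/
def verts {V : Type*} [DecidableEq V] (E : Finset (V × V)) : Finset V :=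
  E.image Prod.fst ∪ E.image Prod.snd

lemma fst_mem_verts {V : Type*} [DecidableEq V] {E : Finset (V × V)} {e : V × V} (he : e ∈ E) :
    e.1 ∈ verts E :=
  mem_union_left _ (mem_image_of_mem _ he)

lemma snd_mem_verts {V : Type*} [DecidableEq V] {E : Finset (V × V)} {e : V × V} (he : e ∈ E) :
    e.2 ∈ verts E :=
  mem_union_right _ (mem_image_of_mem _ he)

lemma verts_union {V : Type*} [DecidableEq V] (E F : Finset (V × V)) :
    verts (E ∪ F) = verts E ∪ verts F := by
  simp only [verts, image_union]
  ac_rfl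

lemma verts_mono {V : Type*} [DecidableEq V] {E F : Finset (V × V)} (h : E ⊆ F) :
    verts E ⊆ verts F :=
  union_subset_union (image_subset_image h) (image_subset_image h)

lemma verts_biUnion {V ι : Type*} [DecidableEq V] [DecidableEq ι] (S : Finset ι)
    (E : ι → Finset (V × V)) : verts (S.biUnion E) = S.biUnion fun j => verts (E j) := by
  induction S using Finset.induction_on with
  | empty => simp [verts]
  | insert j S _ ih => rw [biUnion_insert, biUnion_insert, verts_union, ih]

/-- `σ` is obtained from the partial permutation with edge set `E` by closing each of its
paths into a cycle, and `c` is the number of cycles of `E` itself. -/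
structure IsClosure {N : ℕ} (E : Finset (Fin N × Fin N)) (c : ℕ) (σ : Equiv.Perm (Fin N)) :
    Prop where
  map : ∀ e ∈ E, σ e.1 = e.2
  fix : ∀ x ∉ verts E, σ x = x
  sep : ∀ x ∉ E.image Prod.fst, ∀ y ∉ E.image Prod.fst, σ.SameCycle x y → x = y
  count : cycleCount σ + E.card = N + c

lemma isClosure_empty (N : ℕ) : IsClosure (∅ : Finset (Fin N × Fin N)) 0 1 where
  map := by simp
  fix := by simp
  sep := by simp
  count := by simp [cycleCount_one]

lemma exists_isClosure {N : ℕ} (ρ : Equiv.Perm (Fin N)) (E : Finset (Fin N × Fin N))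
    (hE : ∀ e ∈ E, ρ e.1 = e.2) : ∃ c ≤ E.card, ∃ σ, IsClosure E c σ := by
  induction E using Finset.induction_on with
  | empty => exact ⟨0, le_rfl, 1, isClosure_empty N⟩
  | insert e E he ih =>
    obtain ⟨a, s⟩ := e
    obtain ⟨c, hc, σ, hσ⟩ := ih fun e he' => hE e (mem_insert_of_mem he')
    have has : ρ a = s := hE (a, s) (mem_insert_self _ _)
    have ha : a ∉ E.image Prod.fst := by
      intro h
      obtain ⟨⟨a', s'⟩, h', rfl⟩ := mem_image.1 h
      have : ρ a' = s' := hE _ (mem_insert_of_mem h')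
      rw [has] at this
      exact he (this ▸ h')
    have hs : ∀ e ∈ E, e.2 ≠ s := by
      rintro ⟨a', s'⟩ h' h
      have h₁ : ρ a' = s' := hE _ (mem_insert_of_mem h')
      have h₂ : s' = s := h
      have h₃ : a' = a := ρ.injective (by rw [h₁, has, h₂])
      exact he (h₃ ▸ h₂ ▸ h')
    obtain ⟨b, hb⟩ := σ.surjective s
    have hbE : b ∉ E.image Prod.fst := by
      intro h
      obtain ⟨e', h', rfl⟩ := mem_image.1 h
      exact hs e' h' ((hσ.map e' h').symm.trans hb)
    have hcard : (insert (a, s) E).card = E.card + 1 := card_insert_of_notMem he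
    by_cases hab : a = b
    · subst hab
      refine ⟨c + 1, by omega, σ, ?_, ?_, ?_, ?_⟩
      · intro e' h'
        rcases mem_insert.1 h' with rfl | h'
        · exact hb
        · exact hσ.map e' h'
      · exact fun x hx => hσ.fix x fun h => hx (verts_mono (subset_insert _ _) h)
      · intro x hx y hy
        rw [image_insert, mem_insert, not_or] at hx hy
        exact hσ.sep x hx.2 y hy.2
      · have := hσ.count
        omega
    · have hcyc : ¬ σ.SameCycle a b := fun h => hab (hσ.sep a ha b hbE h)
      refine ⟨c, by omega, σ * Equiv.swap a b, ?_, ?_, ?_, ?_⟩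
      · intro e' h'
        rcases mem_insert.1 h' with rfl | h'
        · simpa using hb
        · have h₁ : e'.1 ≠ a := fun h => ha (h ▸ mem_image_of_mem _ h')
          have h₂ : e'.1 ≠ b := fun h => hbE (h ▸ mem_image_of_mem _ h')
          rw [Equiv.Perm.mul_apply, Equiv.swap_apply_of_ne_of_ne h₁ h₂, hσ.map e' h']
      · intro x hx
        have hxE : x ∉ verts E := fun h => hx (verts_mono (subset_insert _ _) h)
        have hxa : x ≠ a := fun h =>
          hx (h ▸ fst_mem_verts (mem_insert_self (a, s) E))
        have hxs : x ≠ s := fun h =>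
          hx (h ▸ snd_mem_verts (mem_insert_self (a, s) E))
        have hxb : x ≠ b := fun h => hxs (by rw [← hb, ← h, hσ.fix x hxE])
        rw [Equiv.Perm.mul_apply, Equiv.swap_apply_of_ne_of_ne hxa hxb, hσ.fix x hxE]
      · intro x hx y hy hxy
        rw [image_insert, mem_insert, not_or] at hx hy
        rcases (sameCycle_mul_swap_iff hcyc x y).1 hxy with h | ⟨h₁ | h₁, h₂⟩
        · exact hσ.sep x hx.2 y hy.2 h
        · exact absurd (hσ.sep a ha x hx.2 h₁).symm hx.1
        · rcases h₂ with h₂ | h₂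
          · exact absurd (hσ.sep a ha y hy.2 h₂).symm hy.1
          · rw [← hσ.sep b hbE x hx.2 h₁, ← hσ.sep b hbE y hy.2 h₂]
      · have h₁ := hσ.count
        have h₂ := cycleCount_mul_swap hcyc
        omega

lemma IsClosure.union {N : ℕ} {E F : Finset (Fin N × Fin N)} {c d : ℕ}
    {σ τ : Equiv.Perm (Fin N)} (hσ : IsClosure E c σ) (hτ : IsClosure F d τ)
    (hEF : Disjoint (verts E) (verts F)) : IsClosure (E ∪ F) (c + d) (σ * τ) := by
  have hdisj : Equiv.Perm.Disjoint σ τ := by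
    intro x
    by_cases hx : x ∈ verts E
    · exact Or.inr (hτ.fix x (Finset.disjoint_left.1 hEF hx))
    · exact Or.inl (hσ.fix x hx)
  have hcomm : Commute σ τ := hdisj.commute
  have hEFd : Disjoint E F := Finset.disjoint_left.2 fun e he hf =>
    Finset.disjoint_left.1 hEF (fst_mem_verts he) (fst_mem_verts hf)
  refine ⟨?_, ?_, ?_, ?_⟩
  · intro e he
    rcases mem_union.1 he with he | he
    · rw [Equiv.Perm.mul_apply, hτ.fix _ (Finset.disjoint_left.1 hEF (fst_mem_verts he)),
        hσ.map e he]
    · rw [hcomm.eq, Equiv.Perm.mul_apply,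
        hσ.fix _ (Finset.disjoint_right.1 hEF (fst_mem_verts he)), hτ.map e he]
  · intro x hx
    rw [verts_union, mem_union, not_or] at hx
    rw [Equiv.Perm.mul_apply, hτ.fix x hx.2, hσ.fix x hx.1]
  · intro x hx y hy hxy
    rw [image_union, mem_union, not_or] at hx hy
    obtain ⟨n, hn⟩ := hxy
    by_cases hxE : x ∈ verts E
    · have hfix : τ x = x := hτ.fix x (Finset.disjoint_left.1 hEF hxE)
      refine hσ.sep x hx.1 y hy.1 ⟨n, ?_⟩
      rw [← hn, hcomm.mul_zpow, Equiv.Perm.mul_apply,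
        Equiv.Perm.zpow_apply_eq_self_of_apply_eq_self hfix]
    · have hfix : σ x = x := hσ.fix x hxE
      refine hτ.sep x hx.2 y hy.2 ⟨n, ?_⟩
      rw [← hn, hcomm.eq, hcomm.symm.mul_zpow, Equiv.Perm.mul_apply,
        Equiv.Perm.zpow_apply_eq_self_of_apply_eq_self hfix]
  · have h₁ := hσ.count
    have h₂ := hτ.count
    have h₃ := cycleCount_mul_of_disjoint hdisj
    rw [card_union_of_disjoint hEFd]
    omega

lemma exists_isClosure_biUnion {N : ℕ} {ι : Type*} [DecidableEq ι]
    {E : ι → Finset (Fin N × Fin N)} {c : ι → ℕ} (S : Finset ι)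
    (hdisj : ∀ j ∈ S, ∀ k ∈ S, j ≠ k → Disjoint (verts (E j)) (verts (E k)))
    (hE : ∀ j ∈ S, ∃ σ, IsClosure (E j) (c j) σ) :
    ∃ σ, IsClosure (S.biUnion E) (∑ j ∈ S, c j) σ := by
  induction S using Finset.induction_on with
  | empty => exact ⟨1, by simpa using isClosure_empty N⟩
  | insert j S hj ih =>
    obtain ⟨σ, hσ⟩ := hE j (mem_insert_self _ _)
    obtain ⟨τ, hτ⟩ := ih
      (fun k hk l hl => hdisj k (mem_insert_of_mem hk) l (mem_insert_of_mem hl))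
      (fun k hk => hE k (mem_insert_of_mem hk))
    refine ⟨σ * τ, ?_⟩
    rw [biUnion_insert, sum_insert hj]
    refine hσ.union hτ ?_
    rw [verts_biUnion, Finset.disjoint_biUnion_right]
    exact fun k hk => hdisj j (mem_insert_self _ _) k (mem_insert_of_mem hk)
      (fun h => hj (h ▸ hk))

/-! ### Moments -/

lemma sum_theta_pow_cycleCount {N : ℕ} (θ : ℝ) (D : Finset (Fin N)) :
    ∀ (σ : Equiv.Perm (Fin N)) (c : ℕ),
      (∀ x ∈ D, ∀ y ∈ D, σ.SameCycle x y → x = y) → cycleCount σ = D.card + c →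
      ∑ τ : Equiv.Perm (Fin N), θ ^ cycleCount τ * (if ∀ x ∉ D, τ x = σ x then 1 else 0) =
        θ ^ c * ∏ k ∈ range D.card, (θ + (k : ℝ)) := by
  induction D using Finset.induction_on with
  | empty =>
    intro σ c _ hc
    rw [Finset.sum_eq_single σ]
    · simp [hc]
    · intro τ _ hτ
      rw [if_neg, mul_zero]
      exact fun h => hτ (Equiv.ext fun x => h x (Finset.notMem_empty x))
    · simp
  | insert a D ha ih =>
    intro σ c hsep hc
    have hDcard : (insert a D).card = D.card + 1 := card_insert_of_notMem ha
    have hpart : ∀ τ : Equiv.Perm (Fin N),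
        (if ∀ x ∉ insert a D, τ x = σ x then (1 : ℝ) else 0) =
          ∑ b ∈ insert a D, if ∀ x ∉ D, τ x = (σ * Equiv.swap a b) x then 1 else 0 := by
      intro τ
      have hoff : ∀ b ∈ insert a D, ∀ x ∉ insert a D, (σ * Equiv.swap a b) x = σ x := by
        intro b hb x hx
        rw [Equiv.Perm.mul_apply, Equiv.swap_apply_of_ne_of_ne]
        · exact fun h => hx (h ▸ mem_insert_self _ _)
        · exact fun h => hx (h ▸ hb)
      by_cases hτ : ∀ x ∉ insert a D, τ x = σ x
      · rw [if_pos hτ]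
        obtain ⟨b, hb⟩ := σ.surjective (τ a)
        have hbD : b ∈ insert a D := by
          by_contra h
          have hba := τ.injective ((hτ b h).trans hb)
          exact h (hba ▸ mem_insert_self _ _)
        rw [Finset.sum_eq_single_of_mem b hbD, if_pos]
        · intro x hx
          by_cases hxa : x = a
          · subst hxa
            simp [hb]
          · have hx' : x ∉ insert a D := by simp [hxa, hx]
            rw [hoff b hbD x hx', hτ x hx']
        · intro b' _ hb'
          rw [if_neg]
          intro h
          have := h a ha
          rw [Equiv.Perm.mul_apply, Equiv.swap_apply_left, ← hb] at this
          exact hb' (σ.injective this).symm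
      · rw [if_neg hτ, Finset.sum_eq_zero]
        intro b hb
        rw [if_neg]
        intro h
        refine hτ fun x hx => ?_
        rw [h x fun hxD => hx (mem_insert_of_mem hxD), hoff b hb x hx]
    simp_rw [hpart, Finset.mul_sum]
    rw [Finset.sum_comm, Finset.sum_insert ha]
    have h₁ := ih σ (c + 1) (fun x hx y hy => hsep x (mem_insert_of_mem hx) y
      (mem_insert_of_mem hy)) (by omega)
    have h₂ : ∀ b ∈ D, ∑ τ : Equiv.Perm (Fin N), θ ^ cycleCount τ *
        (if ∀ x ∉ D, τ x = (σ * Equiv.swap a b) x then 1 else 0) =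
          θ ^ c * ∏ k ∈ range D.card, (θ + (k : ℝ)) := by
      intro b hb
      have hab : ¬ σ.SameCycle a b := fun h =>
        ha (hsep a (mem_insert_self _ _) b (mem_insert_of_mem hb) h ▸ hb)
      refine ih (σ * Equiv.swap a b) c ?_ ?_
      · intro x hx y hy hxy
        have hnot : ∀ z ∈ D, σ.SameCycle a z → False := fun z hz h =>
          ha (hsep a (mem_insert_self _ _) z (mem_insert_of_mem hz) h ▸ hz)
        have hbz : ∀ z ∈ D, σ.SameCycle b z → b = z := fun z hz h =>
          hsep b (mem_insert_of_mem hb) z (mem_insert_of_mem hz) h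
        rcases (sameCycle_mul_swap_iff hab x y).1 hxy with h | ⟨h₁ | h₁, h₂⟩
        · exact hsep x (mem_insert_of_mem hx) y (mem_insert_of_mem hy) h
        · exact (hnot x hx h₁).elim
        · rcases h₂ with h₂ | h₂
          · exact (hnot y hy h₂).elim
          · rw [← hbz x hx h₁, ← hbz y hy h₂]
      · have := cycleCount_mul_swap hab
        omega
    rw [Finset.sum_congr rfl h₂]
    simp only [Equiv.swap_self, ← Equiv.Perm.one_def, mul_one]
    rw [h₁, hDcard, prod_range_succ, sum_const, nsmul_eq_mul]
    ring

/-- The Ewens probability that `σ` contains all the edges in `E`. -/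
def edgeMoment (θ : ℝ) (N : ℕ) (E : Finset (Fin N × Fin N)) : ℝ :=
  ewensE θ N fun σ => if ∀ e ∈ E, σ e.1 = e.2 then 1 else 0

lemma edgeMoment_of_isClosure {θ : ℝ} {N : ℕ} {E : Finset (Fin N × Fin N)} {c : ℕ}
    {σ : Equiv.Perm (Fin N)} (h : IsClosure E c σ) :
    E.card ≤ N ∧ edgeMoment θ N E =
      θ ^ c * ((∏ k ∈ range (N - E.card), (θ + (k : ℝ))) / ∏ k ∈ range N, (θ + (k : ℝ))) := by
  have hcard : (E.image Prod.fst).card = E.card := by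
    refine card_image_of_injOn fun e he f hf hef => ?_
    refine Prod.ext hef ?_
    rw [← h.map e he, ← h.map f hf]
    exact congrArg σ hef
  have hle : E.card ≤ N := by
    rw [← hcard]
    simpa using Finset.card_le_univ (E.image Prod.fst)
  refine ⟨hle, ?_⟩
  have hD : ((E.image Prod.fst)ᶜ).card = N - E.card := by
    rw [card_compl, hcard, Fintype.card_fin]
  have key := sum_theta_pow_cycleCount θ (E.image Prod.fst)ᶜ σ c
    (fun x hx y hy => h.sep x (mem_compl.1 hx) y (mem_compl.1 hy))
    (by have := h.count; omega)
  rw [edgeMoment, ewensE, ← mul_div_assoc, ← hD, ← key]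
  congr 1
  refine Finset.sum_congr rfl fun τ _ => ?_
  congr 1
  refine if_congr ?_ rfl rfl
  simp only [mem_compl, not_not]
  constructor
  · intro hτ x hx
    obtain ⟨e, he, rfl⟩ := mem_image.1 hx
    rw [hτ e he, h.map e he]
  · intro hτ e he
    rw [hτ e.1 (mem_image_of_mem _ he), h.map e he]

lemma edgeMoment_empty {θ : ℝ} (hθ : 0 < θ) (N : ℕ) :
    edgeMoment θ N (∅ : Finset (Fin N × Fin N)) = 1 := by
  rw [(edgeMoment_of_isClosure (isClosure_empty N)).2]
  have : ∏ k ∈ range N, (θ + (k : ℝ)) ≠ 0 :=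
    Finset.prod_ne_zero_iff.2 fun k _ => by positivity
  simp [div_self this]

/-! ### Subset convolution and cumulants -/

/-- The convolution product on functions of finite sets. -/
def subsetConv {ι 𝕜 : Type*} [DecidableEq ι] [Field 𝕜] (f g : Finset ι → 𝕜) (S : Finset ι) : 𝕜 :=
  ∑ A ∈ S.powerset, f A * g (S \ A)

/-- The inverse of `M` for the subset convolution, as a sum over set partitions. -/
def subsetInv {ι 𝕜 : Type*} [DecidableEq ι] [Field 𝕜] (M : Finset ι → 𝕜) (S : Finset ι) : 𝕜 :=
  ∑ P ∈ partitionsOf S, (-1 : 𝕜) ^ P.card * (P.card.factorial : 𝕜) * ∏ C ∈ P, M C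

section Cumulants

variable {ι 𝕜 : Type*} [DecidableEq ι] [Field 𝕜]

lemma mem_partitionsOf {S : Finset ι} {P : Finset (Finset ι)} :
    P ∈ partitionsOf S ↔ (∀ C ∈ P, C ⊆ S) ∧ (∀ C ∈ P, C.Nonempty) ∧
      ∀ j ∈ S, ∃! C, C ∈ P ∧ j ∈ C := by
  simp only [partitionsOf, mem_filter, mem_powerset, subset_iff]

lemma partitionsOf_block_unique {S : Finset ι} {P : Finset (Finset ι)} (hP : P ∈ partitionsOf S)
    {C D : Finset ι} (hC : C ∈ P) (hD : D ∈ P) {j : ι} (hjC : j ∈ C) (hjD : j ∈ D) : C = D := by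
  rw [mem_partitionsOf] at hP
  exact (hP.2.2 j (hP.1 C hC hjC)).unique ⟨hC, hjC⟩ ⟨hD, hjD⟩

lemma partitionsOf_empty : partitionsOf (∅ : Finset ι) = {∅} := by
  ext P
  rw [mem_partitionsOf, mem_singleton]
  constructor
  · rintro ⟨h₁, h₂, -⟩
    refine Finset.eq_empty_of_forall_notMem fun C hC => ?_
    obtain ⟨x, hx⟩ := h₂ C hC
    exact Finset.notMem_empty x (h₁ C hC hx)
  · rintro rfl
    simp

lemma erase_mem_partitionsOf {S : Finset ι} {P : Finset (Finset ι)} (hP : P ∈ partitionsOf S)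
    {C : Finset ι} (hC : C ∈ P) : P.erase C ∈ partitionsOf (S \ C) := by
  have hP' := mem_partitionsOf.1 hP
  rw [mem_partitionsOf]
  refine ⟨fun D hD x hx => mem_sdiff.2 ⟨hP'.1 D (mem_of_mem_erase hD) hx, fun hxC => ?_⟩,
    fun D hD => hP'.2.1 D (mem_of_mem_erase hD), fun j hj => ?_⟩
  · exact ne_of_mem_erase hD (partitionsOf_block_unique hP (mem_of_mem_erase hD) hC hx hxC)
  · obtain ⟨D, ⟨hD, hjD⟩, huniq⟩ := hP'.2.2 j (mem_sdiff.1 hj).1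
    refine ⟨D, ⟨mem_erase.2 ⟨fun h => (mem_sdiff.1 hj).2 (h ▸ hjD), hD⟩, hjD⟩, ?_⟩
    rintro D' ⟨hD', hjD'⟩
    exact huniq D' ⟨mem_of_mem_erase hD', hjD'⟩

lemma notMem_of_mem_partitionsOf_sdiff {S C : Finset ι} (hC : C.Nonempty)
    {Q : Finset (Finset ι)} (hQ : Q ∈ partitionsOf (S \ C)) : C ∉ Q := by
  intro h
  obtain ⟨x, hx⟩ := hC
  exact (mem_sdiff.1 ((mem_partitionsOf.1 hQ).1 C h hx)).2 hx

lemma insert_mem_partitionsOf {S C : Finset ι} (hCS : C ⊆ S) (hC : C.Nonempty)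
    {Q : Finset (Finset ι)} (hQ : Q ∈ partitionsOf (S \ C)) : insert C Q ∈ partitionsOf S := by
  have hQ' := mem_partitionsOf.1 hQ
  rw [mem_partitionsOf]
  refine ⟨fun D hD => ?_, fun D hD => ?_, fun j hj => ?_⟩
  · rcases mem_insert.1 hD with rfl | hD
    · exact hCS
    · exact (hQ'.1 D hD).trans sdiff_subset
  · rcases mem_insert.1 hD with rfl | hD
    · exact hC
    · exact hQ'.2.1 D hD
  · by_cases hjC : j ∈ C
    · refine ⟨C, ⟨mem_insert_self _ _, hjC⟩, ?_⟩
      rintro D ⟨hD, hjD⟩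
      rcases mem_insert.1 hD with rfl | hD
      · rfl
      · exact absurd hjC (mem_sdiff.1 (hQ'.1 D hD hjD)).2
    · obtain ⟨D, ⟨hD, hjD⟩, huniq⟩ := hQ'.2.2 j (mem_sdiff.2 ⟨hj, hjC⟩)
      refine ⟨D, ⟨mem_insert_of_mem hD, hjD⟩, ?_⟩
      rintro D' ⟨hD', hjD'⟩
      rcases mem_insert.1 hD' with rfl | hD'
      · exact absurd hjD' hjC
      · exact huniq D' ⟨hD', hjD'⟩

lemma sum_partitionsOf_marked (S : Finset ι) (F : Finset ι → Finset (Finset ι) → 𝕜) :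
    ∑ P ∈ partitionsOf S, ∑ C ∈ P, F C (P.erase C) =
      ∑ C ∈ S.powerset, if C.Nonempty then ∑ Q ∈ partitionsOf (S \ C), F C Q else 0 := by
  rw [← Finset.sum_filter, Finset.sum_sigma', Finset.sum_sigma']
  refine Finset.sum_bij' (fun p _ => ⟨p.2, p.1.erase p.2⟩) (fun q _ => ⟨insert q.1 q.2, q.1⟩)
    ?_ ?_ ?_ ?_ ?_
  · rintro ⟨P, C⟩ h
    obtain ⟨hP, hC⟩ := mem_sigma.1 h
    have hP' := mem_partitionsOf.1 hP
    exact mem_sigma.2 ⟨mem_filter.2 ⟨mem_powerset.2 (hP'.1 C hC), hP'.2.1 C hC⟩,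
      erase_mem_partitionsOf hP hC⟩
  · rintro ⟨C, Q⟩ h
    obtain ⟨hC, hQ⟩ := mem_sigma.1 h
    obtain ⟨hCS, hCn⟩ := mem_filter.1 hC
    exact mem_sigma.2 ⟨insert_mem_partitionsOf (mem_powerset.1 hCS) hCn hQ, mem_insert_self _ _⟩
  · rintro ⟨P, C⟩ h
    simp only [insert_erase (mem_sigma.1 h).2]
  · rintro ⟨C, Q⟩ h
    obtain ⟨hC, hQ⟩ := mem_sigma.1 h
    simp only [erase_insert (notMem_of_mem_partitionsOf_sdiff (mem_filter.1 hC).2 hQ)]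
  · rintro ⟨P, C⟩ _
    rfl

lemma subsetConv_comm (f g : Finset ι → 𝕜) (S : Finset ι) :
    subsetConv f g S = subsetConv g f S := by
  unfold subsetConv
  refine Finset.sum_bij' (fun A _ => S \ A) (fun A _ => S \ A) ?_ ?_ ?_ ?_ ?_
  · intro A _
    exact mem_powerset.2 sdiff_subset
  · intro A _
    exact mem_powerset.2 sdiff_subset
  · intro A hA
    exact Finset.sdiff_sdiff_eq_self (mem_powerset.1 hA)
  · intro A hA
    exact Finset.sdiff_sdiff_eq_self (mem_powerset.1 hA)
  · intro A hA
    rw [Finset.sdiff_sdiff_eq_self (mem_powerset.1 hA), mul_comm]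

lemma subsetConv_assoc (f g h : Finset ι → 𝕜) (S : Finset ι) :
    subsetConv (subsetConv f g) h S = subsetConv f (subsetConv g h) S := by
  simp only [subsetConv, Finset.sum_mul, Finset.mul_sum]
  rw [Finset.sum_sigma', Finset.sum_sigma']
  refine Finset.sum_bij' (fun p _ => ⟨p.2, p.1 \ p.2⟩) (fun q _ => ⟨q.1 ∪ q.2, q.1⟩) ?_ ?_ ?_ ?_ ?_
  · rintro ⟨C, A⟩ hp
    simp only [mem_sigma, mem_powerset] at hp ⊢
    exact ⟨hp.2.trans hp.1, sdiff_subset_sdiff hp.1 subset_rfl⟩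
  · rintro ⟨A, B⟩ hp
    simp only [mem_sigma, mem_powerset] at hp ⊢
    exact ⟨union_subset hp.1 (hp.2.trans sdiff_subset), subset_union_left⟩
  · rintro ⟨C, A⟩ hp
    simp only [mem_sigma, mem_powerset] at hp
    simp only [union_sdiff_of_subset hp.2]
  · rintro ⟨A, B⟩ hp
    simp only [mem_sigma, mem_powerset] at hp
    have : Disjoint B A := disjoint_of_subset_left hp.2 sdiff_disjoint
    simp only [union_sdiff_left, sdiff_eq_self_of_disjoint this]
  · rintro ⟨C, A⟩ hp
    simp only [mem_sigma, mem_powerset] at hp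
    have : (S \ A) \ (C \ A) = S \ C := by
      ext x
      have h₁ := @hp.1 x
      have h₂ := @hp.2 x
      simp only [mem_sdiff]
      tauto
    simp only [this, mul_assoc]

lemma subsetConv_congr {f f' g g' : Finset ι → 𝕜} {S : Finset ι} (hf : ∀ A ⊆ S, f A = f' A)
    (hg : ∀ A ⊆ S, g A = g' A) : subsetConv f g S = subsetConv f' g' S :=
  Finset.sum_congr rfl fun A hA => by rw [hf A (mem_powerset.1 hA), hg _ sdiff_subset]

lemma subsetConv_unit (f : Finset ι → 𝕜) (S : Finset ι) :
    subsetConv f (fun A => if A = ∅ then 1 else 0) S = f S := by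
  unfold subsetConv
  rw [Finset.sum_eq_single_of_mem S (mem_powerset.2 subset_rfl)]
  · simp
  · intro A hA hne
    have : S \ A ≠ ∅ := fun h =>
      hne (subset_antisymm (mem_powerset.1 hA) (sdiff_eq_empty_iff_subset.1 h))
    simp [this]

lemma subsetInv_empty (M : Finset ι → 𝕜) : subsetInv M ∅ = 1 := by
  simp [subsetInv, partitionsOf_empty]

lemma subsetConv_subsetInv {M : Finset ι → 𝕜} (hM : M ∅ = 1) (S : Finset ι) :
    subsetConv M (subsetInv M) S = if S = ∅ then 1 else 0 := by
  split_ifs with hS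
  · subst hS
    simp [subsetConv, hM, subsetInv_empty]
  · have hinv : subsetInv M S = ∑ P ∈ partitionsOf S, ∑ C ∈ P,
        -(M C * ((-1 : 𝕜) ^ (P.erase C).card * ((P.erase C).card.factorial : 𝕜) *
          ∏ D ∈ P.erase C, M D)) := by
      refine Finset.sum_congr rfl fun P hP => ?_
      have hPne : P.card ≠ 0 := by
        intro h
        obtain ⟨j, hj⟩ := Finset.nonempty_iff_ne_empty.2 hS
        obtain ⟨C, ⟨hC, -⟩, -⟩ := (mem_partitionsOf.1 hP).2.2 j hj
        rw [Finset.card_eq_zero.1 h] at hC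
        exact Finset.notMem_empty C hC
      obtain ⟨n, hn⟩ := Nat.exists_eq_succ_of_ne_zero hPne
      have : ∀ C ∈ P, -(M C * ((-1 : 𝕜) ^ (P.erase C).card * ((P.erase C).card.factorial : 𝕜) *
          ∏ D ∈ P.erase C, M D)) = (-1) ^ (n + 1) * (n.factorial : 𝕜) * ∏ D ∈ P, M D := by
        intro C hC
        rw [card_erase_of_mem hC, hn, Nat.succ_sub_one, ← Finset.mul_prod_erase P M hC]
        ring
      rw [Finset.sum_congr rfl this, Finset.sum_const, hn, Nat.succ_eq_add_one,
        Nat.factorial_succ, nsmul_eq_mul]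
      push_cast
      ring
    rw [sum_partitionsOf_marked S fun C Q => -(M C * ((-1 : 𝕜) ^ Q.card *
      (Q.card.factorial : 𝕜) * ∏ D ∈ Q, M D))] at hinv
    unfold subsetConv
    rw [← Finset.add_sum_erase _ _ (empty_mem_powerset S), hM, one_mul, sdiff_empty, hinv,
      ← Finset.add_sum_erase _ _ (empty_mem_powerset S), if_neg Finset.not_nonempty_empty,
      zero_add, ← Finset.sum_add_distrib]
    refine Finset.sum_eq_zero fun C hC => ?_
    rw [if_pos (Finset.nonempty_iff_ne_empty.2 (ne_of_mem_erase hC)), subsetInv, Finset.mul_sum,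
      Finset.sum_neg_distrib, neg_add_cancel]

lemma cumulantOn_insert (M : Finset ι → 𝕜) {S : Finset ι} {j : ι} (hj : j ∉ S) :
    cumulantOn (insert j S) M = subsetConv (fun A => M (insert j A)) (subsetInv M) S := by
  have hmark : cumulantOn (insert j S) M = ∑ P ∈ partitionsOf (insert j S), ∑ C ∈ P,
      if j ∈ C then M C * ((-1 : 𝕜) ^ (P.erase C).card * ((P.erase C).card.factorial : 𝕜) *
        ∏ D ∈ P.erase C, M D) else 0 := by
    refine Finset.sum_congr rfl fun P hP => ?_
    obtain ⟨C, ⟨hC, hjC⟩, huniq⟩ := (mem_partitionsOf.1 hP).2.2 j (mem_insert_self _ _)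
    rw [Finset.sum_eq_single_of_mem C hC, if_pos hjC, card_erase_of_mem hC,
      ← Finset.mul_prod_erase P M hC]
    · ring
    · intro D hD hne
      rw [if_neg fun hjD => hne (huniq D ⟨hD, hjD⟩)]
  rw [sum_partitionsOf_marked (insert j S) fun C Q => if j ∈ C then M C * ((-1 : 𝕜) ^ Q.card *
      (Q.card.factorial : 𝕜) * ∏ D ∈ Q, M D) else 0] at hmark
  rw [hmark, Finset.sum_powerset_insert hj, Finset.sum_eq_zero, zero_add]
  · refine Finset.sum_congr rfl fun A hA => ?_
    have hsd : insert j S \ insert j A = S \ A := by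
      rw [insert_sdiff_of_mem _ (mem_insert_self _ _), sdiff_insert_of_notMem hj]
    simp only [insert_nonempty, mem_insert_self, if_true, hsd, subsetInv, Finset.mul_sum]
  · intro A hA
    have : j ∉ A := fun h => hj (mem_powerset.1 hA h)
    simp [this]

lemma subsetConv_cancel {M f g : Finset ι → 𝕜} (hM : M ∅ = 1) {S : Finset ι}
    (h : ∀ T ⊆ S, subsetConv f M T = subsetConv g M T) : f S = g S := by
  have key : ∀ f : Finset ι → 𝕜, f S = subsetConv (subsetConv f M) (subsetInv M) S := by
    intro f
    rw [subsetConv_assoc, subsetConv_congr (fun _ _ => rfl)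
      fun A _ => subsetConv_subsetInv hM A, subsetConv_unit]
  rw [key f, key g]
  exact subsetConv_congr h fun _ _ => rfl

lemma subsetConv_cumulantOn {M : Finset ι → 𝕜} (hM : M ∅ = 1) {S : Finset ι} {j : ι}
    (hj : j ∉ S) : subsetConv (fun A => cumulantOn (insert j A) M) M S = M (insert j S) := by
  rw [subsetConv_congr (fun A hA => cumulantOn_insert M fun h => hj (hA h)) fun _ _ => rfl,
    subsetConv_assoc, subsetConv_congr (fun _ _ => rfl) fun A _ => by
      rw [subsetConv_comm, subsetConv_subsetInv hM A], subsetConv_unit]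

lemma cumulantOn_congr {M M' : Finset ι → 𝕜} {S : Finset ι} (h : ∀ A ⊆ S, M A = M' A) :
    cumulantOn S M = cumulantOn S M' := by
  refine Finset.sum_congr rfl fun P hP => ?_
  rw [Finset.prod_congr rfl fun C hC => h C ((mem_partitionsOf.1 hP).1 C hC)]

/-- Replacing two variables by their product: the cumulant of the merged family. -/
lemma cumulantOn_merge {M M' : Finset ι → 𝕜} (hM : M ∅ = 1) {U : Finset ι} {j k : ι}
    (hj : j ∉ U) (hk : k ∉ U) (hjk : j ≠ k) (h₀ : ∀ A ⊆ U, M' A = M A)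
    (h₁ : ∀ A ⊆ U, M' (insert j A) = M (insert j (insert k A))) :
    cumulantOn (insert j U) M' = cumulantOn (insert j (insert k U)) M +
      subsetConv (fun A => cumulantOn (insert j A) M) (fun A => cumulantOn (insert k A) M) U := by
  have hM' : M' ∅ = 1 := by rw [h₀ ∅ (empty_subset _), hM]
  refine subsetConv_cancel (f := fun A => cumulantOn (insert j A) M')
    (g := fun A => cumulantOn (insert j (insert k A)) M +
      subsetConv (fun A => cumulantOn (insert j A) M) (fun A => cumulantOn (insert k A) M) A)
    hM (S := U) fun T hT => ?_
  have hjT : j ∉ T := fun h => hj (hT h)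
  have hkT : k ∉ T := fun h => hk (hT h)
  have e₁ : subsetConv (fun A => cumulantOn (insert j A) M') M T = M (insert j (insert k T)) := by
    rw [← h₁ T hT, ← subsetConv_cumulantOn hM' hjT]
    exact subsetConv_congr (fun _ _ => rfl) fun A hA => (h₀ A (hA.trans hT)).symm
  have hjkT : j ∉ insert k T := by simp [hjk, hjT]
  rw [e₁, ← subsetConv_cumulantOn hM hjkT]
  have e₂ : subsetConv (subsetConv (fun A => cumulantOn (insert j A) M)
      fun A => cumulantOn (insert k A) M) M T =
      ∑ A ∈ T.powerset, cumulantOn (insert j A) M * M (insert k T \ A) := by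
    rw [subsetConv_assoc]
    refine Finset.sum_congr rfl fun A hA => ?_
    rw [subsetConv_cumulantOn hM fun h => hkT (sdiff_subset h), insert_sdiff_of_notMem _
      fun h => hkT (mem_powerset.1 hA h)]
  simp only [subsetConv] at e₂ ⊢
  rw [Finset.sum_powerset_insert hkT, ← e₂, add_comm, ← Finset.sum_add_distrib]
  refine Finset.sum_congr rfl fun A hA => ?_
  have hsd : insert k T \ insert k A = T \ A := by
    rw [insert_sdiff_of_mem _ (mem_insert_self _ _), sdiff_insert_of_notMem hkT]
  rw [add_mul, hsd]

lemma sum_mul_eq_subsetConv {M : Finset ι → 𝕜} (hM : M ∅ = 1) (m : ι → 𝕜) (T : Finset ι) :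
    (∑ i ∈ T, m i) * M T = subsetConv (fun A => (∑ i ∈ A, m i) * cumulantOn A M) M T := by
  have key : ∀ i ∈ T, M T = ∑ A ∈ T.powerset, if i ∈ A then cumulantOn A M * M (T \ A) else 0 := by
    intro i hi
    have hne : i ∉ T.erase i := notMem_erase i T
    conv_lhs => rw [← insert_erase hi]
    conv_rhs => rw [← insert_erase hi]
    rw [Finset.sum_powerset_insert hne, Finset.sum_eq_zero, zero_add,
      ← subsetConv_cumulantOn hM hne]
    · refine Finset.sum_congr rfl fun A hA => ?_
      rw [if_pos (mem_insert_self _ _), insert_sdiff_of_mem _ (mem_insert_self _ _),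
        sdiff_insert_of_notMem hne]
    · intro A hA
      rw [if_neg fun h => hne (mem_powerset.1 hA h)]
  rw [Finset.sum_mul, Finset.sum_congr rfl fun i hi => by
    conv_lhs => rw [key i hi]]
  simp_rw [Finset.mul_sum]
  rw [Finset.sum_comm]
  refine Finset.sum_congr rfl fun A hA => ?_
  simp only [Finset.sum_mul]
  rw [← Finset.sum_subset (mem_powerset.1 hA)]
  · refine Finset.sum_congr rfl fun i hi => ?_
    rw [if_pos hi, mul_assoc]
  · intro i _ hi
    rw [if_neg hi, mul_zero]

/-- A linear relation between two moment functions translates into a quadratic recursion for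
their cumulants. -/
lemma cumulantOn_recursion {M M' : Finset ι → 𝕜} (hM : M ∅ = 1) {S : Finset ι} {j : ι}
    (hj : j ∉ S) (m : ι → 𝕜) (X : 𝕜) (h₀ : ∀ A ⊆ S, M' A = M A)
    (h₁ : ∀ A ⊆ S, (X - ∑ i ∈ A, m i) * M (insert j A) = M' (insert j A)) :
    (X - ∑ i ∈ S, m i) * cumulantOn (insert j S) M =
      subsetConv (fun A => cumulantOn (insert j A) M)
        (fun A => (∑ i ∈ A, m i) * cumulantOn A M) S + cumulantOn (insert j S) M' := by
  have hM' : M' ∅ = 1 := by rw [h₀ ∅ (empty_subset _), hM]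
  refine subsetConv_cancel (f := fun A => (X - ∑ i ∈ A, m i) * cumulantOn (insert j A) M)
    (g := fun A => subsetConv (fun A => cumulantOn (insert j A) M)
        (fun A => (∑ i ∈ A, m i) * cumulantOn A M) A + cumulantOn (insert j A) M')
    hM (S := S) fun T hT => ?_
  have hjT : j ∉ T := fun h => hj (hT h)
  have e₁ : subsetConv (fun A => cumulantOn (insert j A) M') M T = M' (insert j T) := by
    rw [← subsetConv_cumulantOn hM' hjT]
    exact subsetConv_congr (fun _ _ => rfl) fun A hA => (h₀ A (hA.trans hT)).symm
  have e₂ : subsetConv (subsetConv (fun A => cumulantOn (insert j A) M)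
      fun A => (∑ i ∈ A, m i) * cumulantOn A M) M T =
      ∑ A ∈ T.powerset, cumulantOn (insert j A) M * ((∑ i ∈ T \ A, m i) * M (T \ A)) := by
    rw [subsetConv_assoc]
    exact Finset.sum_congr rfl fun A _ => by rw [sum_mul_eq_subsetConv hM]
  have e₃ := subsetConv_cumulantOn hM hjT
  have e₄ := h₁ T hT
  rw [← e₁, ← e₃] at e₄
  simp only [subsetConv] at e₂ e₄ ⊢
  simp_rw [add_mul]
  rw [Finset.sum_add_distrib, e₂, ← e₄, Finset.mul_sum, ← Finset.sum_add_distrib]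
  refine Finset.sum_congr rfl fun A hA => ?_
  rw [← Finset.sum_sdiff (mem_powerset.1 hA)]
  ring

end Cumulants

/-! ### Cumulants of a vertex-disjoint family -/

/-- The ratio `θ(θ+1)⋯(θ+N-k-1) / θ(θ+1)⋯(θ+N-1)`. -/
def risingRatio (θ : ℝ) (N k : ℕ) : ℝ :=
  (∏ i ∈ range (N - k), (θ + (i : ℝ))) / ∏ i ∈ range N, (θ + (i : ℝ))

lemma risingRatio_zero {θ : ℝ} (hθ : 0 < θ) (N : ℕ) : risingRatio θ N 0 = 1 := by
  have : ∏ i ∈ range N, (θ + (i : ℝ)) ≠ 0 := Finset.prod_ne_zero_iff.2 fun i _ => by positivity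
  simp [risingRatio, div_self this]

lemma risingRatio_succ {θ : ℝ} {N k : ℕ} (hk : k + 1 ≤ N) :
    ((N : ℝ) + θ - (k + 1)) * risingRatio θ N (k + 1) = risingRatio θ N k := by
  obtain ⟨d, rfl⟩ := Nat.exists_eq_add_of_le hk
  have h₁ : k + 1 + d - (k + 1) = d := by omega
  have h₂ : k + 1 + d - k = d + 1 := by omega
  rw [risingRatio, risingRatio, h₁, h₂, prod_range_succ]
  push_cast
  ring

lemma mul_le_add_sub {θ : ℝ} (hθ : 0 < θ) {N L m : ℕ} (hmL : m ≤ L) (hmN : m ≤ N) :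
    θ / (θ + L) * N ≤ (N : ℝ) + θ - m := by
  have h₁ : (m : ℝ) ≤ L := by exact_mod_cast hmL
  have h₂ : (m : ℝ) ≤ N := by exact_mod_cast hmN
  have hL : (0 : ℝ) ≤ L := Nat.cast_nonneg L
  rw [div_mul_eq_mul_div, div_le_iff₀ (by positivity)]
  nlinarith [mul_nonneg (sub_nonneg.2 h₂) hL, mul_le_mul_of_nonneg_left h₁ hθ.le]

/-- Moments of a family of variables with weights `w` and `m i` edges in the `i`-th cluster. -/
def weightedMoment {ι : Type*} (θ : ℝ) (N : ℕ) (w : ι → ℝ) (m : ι → ℕ) (A : Finset ι) : ℝ :=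
  (∏ i ∈ A, w i) * risingRatio θ N (∑ i ∈ A, m i)

lemma weightedMoment_empty {ι : Type*} {θ : ℝ} (hθ : 0 < θ) (N : ℕ) (w : ι → ℝ) (m : ι → ℕ) :
    weightedMoment θ N w m ∅ = 1 := by
  simp [weightedMoment, risingRatio_zero hθ]

section Bounds

variable {ι : Type*} [DecidableEq ι]

lemma cumulantOn_weightedMoment_of_eq_zero {θ : ℝ} (hθ : 0 < θ) {N : ℕ} {U : Finset ι} {j : ι}
    (hj : j ∉ U) {w : ι → ℝ} {m : ι → ℕ} (hmj : m j = 0) :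
    cumulantOn (insert j U) (weightedMoment θ N w m) = if U = ∅ then w j else 0 := by
  refine subsetConv_cancel (f := fun A => cumulantOn (insert j A) (weightedMoment θ N w m))
    (g := fun A => if A = ∅ then w j else 0) (weightedMoment_empty hθ N w m) (S := U)
    fun T hT => ?_
  have hjT : j ∉ T := fun h => hj (hT h)
  rw [subsetConv_cumulantOn (weightedMoment_empty hθ N w m) hjT, subsetConv,
    Finset.sum_eq_single_of_mem ∅ (empty_mem_powerset T)]
  · simp [weightedMoment, prod_insert hjT, sum_insert hjT, hmj, mul_assoc]
  · intro A _ hA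
    simp [hA]

lemma cumulantOn_weightedMoment_recursion {θ : ℝ} (hθ : 0 < θ) {N : ℕ} {U : Finset ι} {j : ι}
    (hj : j ∉ U) {w : ι → ℝ} {m : ι → ℕ} {p : ℕ} (hmj : m j = p + 1)
    (hm : ∑ i ∈ insert j U, m i ≤ N) :
    ((N : ℝ) + θ - (∑ i ∈ insert j U, m i : ℕ)) *
        cumulantOn (insert j U) (weightedMoment θ N w m) =
      subsetConv (fun A => cumulantOn (insert j A) (weightedMoment θ N w m))
        (fun A => (∑ i ∈ A, (m i : ℝ)) * cumulantOn A (weightedMoment θ N w m)) U +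
      cumulantOn (insert j U) (weightedMoment θ N w (Function.update m j p)) := by
  have hupd : ∀ A ⊆ U, ∑ i ∈ A, Function.update m j p i = ∑ i ∈ A, m i := fun A hA =>
    Finset.sum_congr rfl fun i hi => by
      have hij : i ≠ j := fun h => hj (h ▸ hA hi)
      rw [Function.update_of_ne hij]
  have := cumulantOn_recursion (M := weightedMoment θ N w m)
    (M' := weightedMoment θ N w (Function.update m j p)) (weightedMoment_empty hθ N w m) hj
    (fun i => (m i : ℝ)) ((N : ℝ) + θ - m j) (fun A hA => by
      rw [weightedMoment, weightedMoment, hupd A hA]) (fun A hA => by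
      have hjA : j ∉ A := fun h => hj (hA h)
      have hle : (p + ∑ i ∈ A, m i) + 1 ≤ N := by
        have h₁ := Finset.sum_le_sum_of_subset (f := m) hA
        rw [sum_insert hj, hmj] at hm
        omega
      have hr := risingRatio_succ (θ := θ) hle
      rw [weightedMoment, weightedMoment, sum_insert hjA, sum_insert hjA, hupd A hA,
        Function.update_self, hmj, add_right_comm p 1, ← hr]
      push_cast
      ring)
  rw [← this, sum_insert hj]
  push_cast
  ring

lemma exists_cumulantOn_weightedMoment_le {θ : ℝ} (hθ : 0 < θ) (L : ℕ) {K : ℝ} (hK : 0 ≤ K)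
    (n : ℕ) :
    ∃ C : ℝ, 0 ≤ C ∧ ∀ N : ℕ, 1 ≤ N → ∀ S : Finset ι, S.Nonempty → S.card ≤ n →
      ∀ (m : ι → ℕ) (w : ι → ℝ), (∀ i ∈ S, |w i| ≤ K) → ∑ i ∈ S, m i ≤ L → ∑ i ∈ S, m i ≤ N →
        |cumulantOn S (weightedMoment θ N w m)| ≤
          C * (N : ℝ) ^ (1 - ((S.card + ∑ i ∈ S, m i : ℕ) : ℤ)) := by
  induction n with
  | zero =>
    refine ⟨0, le_rfl, fun N _ S hS hc => ?_⟩
    have := hS.card_pos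
    omega
  | succ n ih =>
    obtain ⟨C, hC, hbound⟩ := ih
    have inner : ∀ p : ℕ, ∃ D : ℝ, 0 ≤ D ∧ ∀ N : ℕ, 1 ≤ N → ∀ (U : Finset ι) (j : ι), j ∉ U →
        U.card = n → ∀ (m : ι → ℕ) (w : ι → ℝ), (∀ i ∈ insert j U, |w i| ≤ K) →
        ∑ i ∈ insert j U, m i ≤ L → ∑ i ∈ insert j U, m i ≤ N → m j ≤ p →
        |cumulantOn (insert j U) (weightedMoment θ N w m)| ≤
          D * (N : ℝ) ^ (1 - (((insert j U).card + ∑ i ∈ insert j U, m i : ℕ) : ℤ)) := by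
      intro p
      induction p with
      | zero =>
        refine ⟨K, hK, fun N hN U j hj _ m w hw _ _ hmj => ?_⟩
        have hmj : m j = 0 := Nat.le_zero.1 hmj
        rw [cumulantOn_weightedMoment_of_eq_zero hθ hj hmj]
        split_ifs with hU
        · subst hU
          simpa [hmj] using hw j (mem_insert_self _ _)
        · rw [abs_zero]
          positivity
      | succ p ihp =>
        obtain ⟨D, hD, hDb⟩ := ihp
        set c : ℝ := θ / (θ + L) with hc
        have hcpos : 0 < c := by positivity
        set B : ℝ := (2 ^ n * (C * (L * C)) + D) / c with hB
        have hB0 : 0 ≤ B := by positivity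
        refine ⟨D + B, by positivity, fun N hN U j hj hU m w hw hmL hmN hmj => ?_⟩
        have hN1 : (1 : ℝ) ≤ N := by exact_mod_cast hN
        have hN0 : (N : ℝ) ≠ 0 := by positivity
        rcases Nat.lt_or_ge (m j) (p + 1) with hlt | hge
        · refine (hDb N hN U j hj hU m w hw hmL hmN (by omega)).trans ?_
          gcongr
          linarith
        have hmj : m j = p + 1 := le_antisymm hmj hge
        set s : ℕ := ∑ i ∈ insert j U, m i with hs
        have hcardS : (insert j U).card = n + 1 := by rw [card_insert_of_notMem hj, hU]
        set z : ℝ := (N : ℝ) ^ (1 - (((insert j U).card + s : ℕ) : ℤ)) with hz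
        have hz0 : 0 < z := by positivity
        have hsum : s = m j + ∑ i ∈ U, m i := by rw [hs, sum_insert hj]
        have hrec := cumulantOn_weightedMoment_recursion hθ (w := w) hj hmj hmN
        have hconv : |subsetConv (fun A => cumulantOn (insert j A) (weightedMoment θ N w m))
            (fun A => (∑ i ∈ A, (m i : ℝ)) * cumulantOn A (weightedMoment θ N w m)) U| ≤
            2 ^ n * (C * (L * C)) * (N * z) := by
          have hterm : ∀ A ∈ U.powerset,
              |cumulantOn (insert j A) (weightedMoment θ N w m) *
                ((∑ i ∈ U \ A, (m i : ℝ)) * cumulantOn (U \ A) (weightedMoment θ N w m))| ≤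
              C * (L * C) * (N * z) := by
            intro A hA
            have hAU := mem_powerset.1 hA
            have hjA : j ∉ A := fun h => hj (hAU h)
            rcases (U \ A).eq_empty_or_nonempty with hempty | hne
            · rw [hempty, sum_empty, zero_mul, mul_zero, abs_zero]
              positivity
            have hsplit := Finset.sum_sdiff (f := m) hAU
            have hcsplit := Finset.card_sdiff_add_card_eq_card hAU
            have hcA : (insert j A).card = A.card + 1 := card_insert_of_notMem hjA
            have hmA : ∑ i ∈ insert j A, m i = m j + ∑ i ∈ A, m i := sum_insert hjA
            have hpos := hne.card_pos
            have b₁ := hbound N hN (insert j A) (insert_nonempty _ _) (by omega) m w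
              (fun i hi => hw i (insert_subset_insert _ hAU hi)) (by omega) (by omega)
            have b₂ := hbound N hN (U \ A) hne (by omega) m w
              (fun i hi => hw i (mem_insert_of_mem (sdiff_subset hi))) (by omega) (by omega)
            have b₃ : |∑ i ∈ U \ A, (m i : ℝ)| ≤ L := by
              rw [abs_of_nonneg (Finset.sum_nonneg fun i _ => Nat.cast_nonneg _)]
              have : ∑ i ∈ U \ A, m i ≤ L := by omega
              exact_mod_cast this
            rw [abs_mul, abs_mul]
            refine (mul_le_mul b₁ (mul_le_mul b₃ b₂ (abs_nonneg _) (by positivity))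
              (by positivity) (by positivity)).trans (le_of_eq ?_)
            have hexp : (N : ℝ) * z =
                (N : ℝ) ^ (1 - (((insert j A).card + ∑ i ∈ insert j A, m i : ℕ) : ℤ)) *
                (N : ℝ) ^ (1 - (((U \ A).card + ∑ i ∈ U \ A, m i : ℕ) : ℤ)) := by
              rw [hz, ← zpow_one_add₀ hN0, ← zpow_add₀ hN0]
              congr 1
              omega
            rw [hexp]
            ring
          refine (Finset.abs_sum_le_sum_abs _ _).trans ((Finset.sum_le_card_nsmul _ _ _ hterm).trans
            (le_of_eq ?_))
          rw [card_powerset, hU, nsmul_eq_mul]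
          push_cast
          ring
        have hprime : |cumulantOn (insert j U)
            (weightedMoment θ N w (Function.update m j p))| ≤ D * (N * z) := by
          have hupd : ∑ i ∈ insert j U, Function.update m j p i = p + ∑ i ∈ U, m i := by
            rw [sum_insert hj, Function.update_self]
            congr 1
            refine Finset.sum_congr rfl fun i hi => ?_
            have hij : i ≠ j := fun h => hj (h ▸ hi)
            rw [Function.update_of_ne hij]
          refine (hDb N hN U j hj hU (Function.update m j p) w hw (by omega) (by omega)
            (by simp)).trans (le_of_eq ?_)
          rw [hupd, hz, ← zpow_one_add₀ hN0]
          congr 2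
          omega
        have hX : c * N ≤ (N : ℝ) + θ - (s : ℕ) := mul_le_add_sub hθ hmL hmN
        have hcN : 0 < c * N := by positivity
        have hmain : |cumulantOn (insert j U) (weightedMoment θ N w m)| * (c * N) ≤
            (2 ^ n * (C * (L * C)) + D) * (N * z) := by
          calc |cumulantOn (insert j U) (weightedMoment θ N w m)| * (c * N)
              ≤ |cumulantOn (insert j U) (weightedMoment θ N w m)| * ((N : ℝ) + θ - (s : ℕ)) := by
                gcongr
            _ = |((N : ℝ) + θ - (s : ℕ)) * cumulantOn (insert j U) (weightedMoment θ N w m)| := by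
                rw [abs_mul, abs_of_pos (hcN.trans_le hX), mul_comm]
            _ ≤ 2 ^ n * (C * (L * C)) * (N * z) + D * (N * z) := by
                rw [hrec]
                exact (abs_add_le _ _).trans (add_le_add hconv hprime)
            _ = _ := by ring
        have hfin : |cumulantOn (insert j U) (weightedMoment θ N w m)| ≤ B * z := by
          rw [← le_div_iff₀ hcN] at hmain
          refine hmain.trans (le_of_eq ?_)
          rw [hB]
          field_simp
        refine hfin.trans ?_
        gcongr
        linarith
    obtain ⟨D, hD, hDb⟩ := inner L
    refine ⟨C + D, by positivity, fun N hN S hS hc m w hw hmL hmN => ?_⟩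
    rcases Nat.lt_or_ge S.card (n + 1) with hlt | hge
    · refine (hbound N hN S hS (by omega) m w hw hmL hmN).trans ?_
      gcongr
      linarith
    · obtain ⟨j, hj⟩ := hS
      have hjS := insert_erase hj
      have hmj : m j ≤ L := (Finset.single_le_sum (fun i _ => Nat.zero_le (m i)) hj).trans hmL
      have := hDb N hN (S.erase j) j (notMem_erase j S) (by rw [card_erase_of_mem hj]; omega)
      rw [hjS] at this
      refine (this m w hw hmL hmN hmj).trans ?_
      gcongr
      linarith

end Bounds

/-! ### Connected edge sets -/

/-- The graph with edge set `E` is connected. -/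
def EdgeConnected {V : Type*} [DecidableEq V] (E : Finset (V × V)) : Prop :=
  ∀ G, Disjoint (verts (E ∩ G)) (verts (E \ G)) → E ∩ G = ∅ ∨ E ⊆ G

section Connected

variable {V : Type*} [DecidableEq V]

lemma edgeConnected_singleton (e : V × V) : EdgeConnected {e} := by
  intro G _
  by_cases he : e ∈ G
  · exact Or.inr (by simpa using he)
  · exact Or.inl (singleton_inter_of_notMem he)

lemma EdgeConnected.union {E F : Finset (V × V)} (hE : EdgeConnected E) (hF : EdgeConnected F)
    (hEF : ¬Disjoint (verts E) (verts F)) : EdgeConnected (E ∪ F) := by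
  intro G hG
  rw [union_inter_distrib_right, union_sdiff_distrib, verts_union, verts_union] at hG
  have h₁ := hE G (hG.mono subset_union_left subset_union_left)
  have h₂ := hF G (hG.mono subset_union_right subset_union_right)
  rw [union_inter_distrib_right]
  rcases h₁ with h₁ | h₁ <;> rcases h₂ with h₂ | h₂
  · exact Or.inl (by rw [h₁, h₂, union_empty])
  · have h₃ : E \ G = E := sdiff_eq_self_iff_disjoint.2 (disjoint_iff_inter_eq_empty.2 h₁)
    rw [h₃, inter_eq_left.2 h₂] at hG
    exact absurd (hG.mono subset_union_right subset_union_left).symm hEF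
  · have h₃ : F \ G = F := sdiff_eq_self_iff_disjoint.2 (disjoint_iff_inter_eq_empty.2 h₂)
    rw [h₃, inter_eq_left.2 h₁] at hG
    exact absurd (hG.mono subset_union_left subset_union_right) hEF
  · exact Or.inr (union_subset h₁ h₂)

lemma card_verts_singleton_le (e : V × V) : (verts {e}).card ≤ 2 := by
  simpa [verts] using card_union_le {e.1} {e.2}

lemma EdgeConnected.card_verts_le {E : Finset (V × V)} (hE : EdgeConnected E) :
    (verts E).card ≤ E.card + 1 := by
  rcases E.eq_empty_or_nonempty with rfl | hne
  · simp [verts]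
  have grow : ∀ k, 1 ≤ k → k ≤ E.card → ∃ F ⊆ E, F.card = k ∧ (verts F).card ≤ k + 1 := by
    intro k hk
    induction k, hk using Nat.le_induction with
    | base =>
      intro _
      obtain ⟨e, he⟩ := hne
      exact ⟨{e}, singleton_subset_iff.2 he, card_singleton e, card_verts_singleton_le e⟩
    | succ k hk ih =>
      intro hkE
      obtain ⟨F, hFE, hF, hFv⟩ := ih (by omega)
      have hnd : ¬Disjoint (verts F) (verts (E \ F)) := by
        intro h
        have h' := hE F (by rwa [inter_eq_right.2 hFE])
        rw [inter_eq_right.2 hFE] at h'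
        rcases h' with h' | h'
        · rw [h', card_empty] at hF
          omega
        · have := card_le_card h'
          omega
      obtain ⟨x, hxF, hx⟩ := Finset.not_disjoint_iff.1 hnd
      obtain ⟨e, he, hxe⟩ : ∃ e ∈ E \ F, x ∈ verts {e} := by
        rcases mem_union.1 hx with hx | hx
        · obtain ⟨e, he, rfl⟩ := mem_image.1 hx
          exact ⟨e, he, fst_mem_verts (mem_singleton_self e)⟩
        · obtain ⟨e, he, rfl⟩ := mem_image.1 hx
          exact ⟨e, he, snd_mem_verts (mem_singleton_self e)⟩
      obtain ⟨heE, heF⟩ := mem_sdiff.1 he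
      refine ⟨{e} ∪ F, union_subset (singleton_subset_iff.2 heE) hFE, ?_, ?_⟩
      · rw [singleton_union, card_insert_of_notMem heF, hF]
      · rw [verts_union]
        have h₁ := card_union_add_card_inter (verts {e}) (verts F)
        have h₂ : 0 < (verts {e} ∩ verts F).card := card_pos.2 ⟨x, mem_inter.2 ⟨hxe, hxF⟩⟩
        have h₃ := card_verts_singleton_le e
        omega
  obtain ⟨F, hFE, hF, hFv⟩ := grow E.card hne.card_pos le_rfl
  rwa [eq_of_subset_of_card_le hFE hF.ge] at hFv

end Connected

/-! ### Cumulants of products of edge indicators -/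

section EdgeMoments

variable {ι : Type*} [DecidableEq ι]

lemma edgeMoment_eq_zero {θ : ℝ} {N : ℕ} {E F : Finset (Fin N × Fin N)} (hFE : F ⊆ E)
    (hF : ¬∃ ρ : Equiv.Perm (Fin N), ∀ e ∈ F, ρ e.1 = e.2) : edgeMoment θ N E = 0 := by
  have h : ∀ σ : Equiv.Perm (Fin N), ¬∀ e ∈ E, σ e.1 = e.2 := fun σ hσ =>
    hF ⟨σ, fun e he => hσ e (hFE he)⟩
  simp only [edgeMoment, ewensE, if_neg (h _), mul_zero, sum_const_zero, zero_div]

lemma abs_cumulantOn_edgeMoment_le_of_disjoint {θ : ℝ} (hθ : 0 < θ) {n L N : ℕ} {C : ℝ}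
    (hC : 0 ≤ C) (hN : 1 ≤ N)
    (hbound : ∀ S : Finset ι, S.Nonempty → S.card ≤ n →
      ∀ (m : ι → ℕ) (w : ι → ℝ), (∀ i ∈ S, |w i| ≤ max 1 θ ^ L) → ∑ i ∈ S, m i ≤ L →
        ∑ i ∈ S, m i ≤ N → |cumulantOn S (weightedMoment θ N w m)| ≤
          C * (N : ℝ) ^ (1 - ((S.card + ∑ i ∈ S, m i : ℕ) : ℤ)))
    {S : Finset ι} (hS : S.Nonempty) (hSn : S.card ≤ n) {E : ι → Finset (Fin N × Fin N)}
    (hE : ∀ j ∈ S, EdgeConnected (E j)) (hL : (S.biUnion E).card ≤ L)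
    (hdisj : ∀ j ∈ S, ∀ k ∈ S, j ≠ k → Disjoint (verts (E j)) (verts (E k))) :
    |cumulantOn S (fun A => edgeMoment θ N (A.biUnion E))| ≤
      C * (N : ℝ) ^ (1 - ((verts (S.biUnion E)).card : ℤ)) := by
  by_cases hρ : ∀ j ∈ S, ∃ ρ : Equiv.Perm (Fin N), ∀ e ∈ E j, ρ e.1 = e.2
  swap
  · push Not at hρ
    obtain ⟨j, hj, hjρ⟩ := hρ
    have hj0 : ¬∃ ρ : Equiv.Perm (Fin N), ∀ e ∈ E j, ρ e.1 = e.2 := by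
      rintro ⟨ρ, h⟩
      obtain ⟨e, he, hne⟩ := hjρ ρ
      exact hne (h e he)
    rw [← insert_erase hj, cumulantOn_insert _ (notMem_erase j S), subsetConv,
      Finset.sum_eq_zero fun A _ => ?_, abs_zero]
    · positivity
    · rw [edgeMoment_eq_zero (subset_biUnion_of_mem E (mem_insert_self j A)) hj0, zero_mul]
  have hcl : ∀ j, ∃ c ≤ (E j).card, j ∈ S → ∃ σ, IsClosure (E j) c σ := by
    intro j
    by_cases hj : j ∈ S
    · obtain ⟨ρ, h⟩ := hρ j hj
      obtain ⟨c, hc, hσ⟩ := exists_isClosure ρ (E j) h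
      exact ⟨c, hc, fun _ => hσ⟩
    · exact ⟨0, Nat.zero_le _, fun h => absurd h hj⟩
  choose c hc hσ using hcl
  have hcard : ∀ A ⊆ S, (A.biUnion E).card = ∑ j ∈ A, (E j).card := fun A hA =>
    card_biUnion fun j hj k hk hjk => Finset.disjoint_left.2 fun e hej hek =>
      Finset.disjoint_left.1 (hdisj j (hA hj) k (hA hk) hjk) (fst_mem_verts hej)
        (fst_mem_verts hek)
  have hclosure : ∀ A ⊆ S, ∃ σ, IsClosure (A.biUnion E) (∑ j ∈ A, c j) σ := fun A hA =>
    exists_isClosure_biUnion A (fun j hj k hk => hdisj j (hA hj) k (hA hk))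
      fun j hj => hσ j (hA hj)
  have hmoment : ∀ A ⊆ S, edgeMoment θ N (A.biUnion E) =
      weightedMoment θ N (fun j => θ ^ c j) (fun j => (E j).card) A := fun A hA => by
    obtain ⟨σ, h⟩ := hclosure A hA
    rw [(edgeMoment_of_isClosure h).2, weightedMoment, prod_pow_eq_pow_sum, ← hcard A hA,
      risingRatio]
  have hmL : ∑ j ∈ S, (E j).card ≤ L := by rwa [← hcard S subset_rfl]
  have hmN : ∑ j ∈ S, (E j).card ≤ N := by
    obtain ⟨σ, h⟩ := hclosure S subset_rfl
    rw [← hcard S subset_rfl]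
    exact (edgeMoment_of_isClosure (θ := θ) h).1
  have hw : ∀ j ∈ S, |θ ^ c j| ≤ max 1 θ ^ L := fun j hj => by
    have hle : c j ≤ L := (hc j).trans ((Finset.single_le_sum (f := fun j => (E j).card)
      (fun i _ => Nat.zero_le _) hj).trans hmL)
    rw [abs_of_pos (by positivity)]
    exact (pow_le_pow_left₀ hθ.le (le_max_right 1 θ) _).trans
      (pow_le_pow_right₀ (le_max_left 1 θ) hle)
  rw [cumulantOn_congr hmoment]
  refine (hbound S hS hSn _ _ hw hmL hmN).trans (mul_le_mul_of_nonneg_left ?_ hC)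
  refine zpow_le_zpow_right₀ (by exact_mod_cast hN) ?_
  have hv : (verts (S.biUnion E)).card ≤ S.card + ∑ j ∈ S, (E j).card := by
    rw [verts_biUnion, card_eq_sum_ones S, ← sum_add_distrib]
    exact card_biUnion_le.trans (Finset.sum_le_sum fun j hj => by
      rw [add_comm]
      exact (hE j hj).card_verts_le)
  omega

lemma exists_cumulantOn_edgeMoment_le {θ : ℝ} (hθ : 0 < θ) (L n : ℕ) :
    ∃ C : ℝ, 0 ≤ C ∧ ∀ N : ℕ, 1 ≤ N → ∀ S : Finset ι, S.Nonempty → S.card ≤ n →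
      ∀ E : ι → Finset (Fin N × Fin N), (∀ j ∈ S, EdgeConnected (E j)) →
        (S.biUnion E).card ≤ L →
        |cumulantOn S (fun A => edgeMoment θ N (A.biUnion E))| ≤
          C * (N : ℝ) ^ (1 - ((verts (S.biUnion E)).card : ℤ)) := by
  induction n with
  | zero =>
    refine ⟨0, le_rfl, fun N _ S hS hc => ?_⟩
    have := hS.card_pos
    omega
  | succ n ih =>
    obtain ⟨C, hC, hbound⟩ := ih
    obtain ⟨D, hD, hdisj_bound⟩ := exists_cumulantOn_weightedMoment_le (ι := ι) hθ L
      (K := max 1 θ ^ L) (by positivity) (n + 1)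
    refine ⟨D + (C + 2 ^ n * (C * C)), by positivity, fun N hN S hS hSn E hE hL => ?_⟩
    have hN1 : (1 : ℝ) ≤ N := by exact_mod_cast hN
    have hN0 : (N : ℝ) ≠ 0 := by positivity
    by_cases hdisj : ∀ j ∈ S, ∀ k ∈ S, j ≠ k → Disjoint (verts (E j)) (verts (E k))
    · refine (abs_cumulantOn_edgeMoment_le_of_disjoint hθ hD hN (hdisj_bound N hN) hS hSn hE hL
        hdisj).trans ?_
      gcongr
      linarith [show 0 ≤ C + 2 ^ n * (C * C) by positivity]
    push Not at hdisj
    obtain ⟨j, hj, k, hk, hjk, hmeet⟩ := hdisj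
    obtain ⟨U, hjU, hkU, rfl⟩ : ∃ U, j ∉ U ∧ k ∉ U ∧ S = insert j (insert k U) := by
      refine ⟨(S.erase j).erase k, by simp, by simp, ?_⟩
      rw [insert_erase (mem_erase.2 ⟨hjk.symm, hk⟩), insert_erase hj]
    have hcardS : (insert j (insert k U)).card = U.card + 2 := by
      rw [card_insert_of_notMem (by simp [hjk, hjU]), card_insert_of_notMem hkU]
    have hUn : U.card + 1 ≤ n := by omega
    set E' := Function.update E j (E j ∪ E k) with hE'
    have hE'j : E' j = E j ∪ E k := Function.update_self _ _ _
    have hE'U : ∀ i ∈ U, E' i = E i := fun i hi => by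
      have hij : i ≠ j := fun h => hjU (h ▸ hi)
      rw [hE', Function.update_of_ne hij]
    have hU' : ∀ A ⊆ U, A.biUnion E' = A.biUnion E := fun A hA =>
      biUnion_congr rfl fun i hi => hE'U i (hA hi)
    have hjU' : ∀ A ⊆ U, (insert j A).biUnion E' = (insert j (insert k A)).biUnion E :=
      fun A hA => by
        rw [biUnion_insert, biUnion_insert, biUnion_insert, hE'j, hU' A hA, union_assoc]
    have hmerge := cumulantOn_merge (M := fun A => edgeMoment θ N (A.biUnion E))
      (M' := fun A => edgeMoment θ N (A.biUnion E')) (by simp [edgeMoment_empty hθ]) hjU hkU hjk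
      (fun A hA => by rw [hU' A hA]) (fun A hA => by rw [hjU' A hA])
    set t := (verts ((insert j (insert k U)).biUnion E)).card with ht
    have hmerged : |cumulantOn (insert j U) (fun A => edgeMoment θ N (A.biUnion E'))| ≤
        C * (N : ℝ) ^ (1 - (t : ℤ)) := by
      have := hbound N hN (insert j U) (insert_nonempty _ _)
        (by rw [card_insert_of_notMem hjU]; omega) E' (fun i hi => by
          rcases mem_insert.1 hi with rfl | hi
          · rw [hE'j]
            exact (hE _ hj).union (hE _ hk) hmeet
          · rw [hE'U i hi]
            exact hE i (mem_insert_of_mem (mem_insert_of_mem hi)))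
        (by rwa [hjU' U subset_rfl])
      rwa [hjU' U subset_rfl] at this
    have hterm : ∀ A ∈ U.powerset,
        |cumulantOn (insert j A) (fun A => edgeMoment θ N (A.biUnion E)) *
          cumulantOn (insert k (U \ A)) (fun A => edgeMoment θ N (A.biUnion E))| ≤
        C * C * (N : ℝ) ^ (1 - (t : ℤ)) := by
      intro A hA
      have hAU := mem_powerset.1 hA
      have hsub₁ : insert j A ⊆ insert j (insert k U) :=
        insert_subset_insert _ (hAU.trans (subset_insert _ _))
      have hsub₂ : insert k (U \ A) ⊆ insert j (insert k U) :=
        (insert_subset_insert _ sdiff_subset).trans (subset_insert _ _)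
      have hunion : insert j A ∪ insert k (U \ A) = insert j (insert k U) := by
        rw [insert_union, union_insert, union_sdiff_of_subset hAU]
      have hc₁ : (insert j A).card ≤ n := (card_insert_le _ _).trans
        (by have := card_le_card hAU; omega)
      have hc₂ : (insert k (U \ A)).card ≤ n := (card_insert_le _ _).trans
        (by have := card_le_card (sdiff_subset (s := U) (t := A)); omega)
      have b₁ := hbound N hN (insert j A) (insert_nonempty _ _) hc₁ E
        (fun i hi => hE i (hsub₁ hi))
        ((card_le_card (biUnion_subset_biUnion_of_subset_left E hsub₁)).trans hL)
      have b₂ := hbound N hN (insert k (U \ A)) (insert_nonempty _ _) hc₂ E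
        (fun i hi => hE i (hsub₂ hi))
        ((card_le_card (biUnion_subset_biUnion_of_subset_left E hsub₂)).trans hL)
      have hcount : t + 1 ≤ (verts ((insert j A).biUnion E)).card +
          (verts ((insert k (U \ A)).biUnion E)).card := by
        rw [← card_union_add_card_inter, ← verts_union, ← union_biUnion, hunion, ← ht,
          add_le_add_iff_left, Nat.one_le_iff_ne_zero, ← Nat.pos_iff_ne_zero, card_pos]
        obtain ⟨x, hxj, hxk⟩ := Finset.not_disjoint_iff.1 hmeet
        exact ⟨x, mem_inter.2
          ⟨verts_mono (subset_biUnion_of_mem E (mem_insert_self j A)) hxj,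
            verts_mono (subset_biUnion_of_mem E (mem_insert_self k _)) hxk⟩⟩
      rw [abs_mul]
      refine (mul_le_mul b₁ b₂ (abs_nonneg _) (by positivity)).trans ?_
      rw [mul_mul_mul_comm, ← zpow_add₀ hN0]
      refine mul_le_mul_of_nonneg_left (zpow_le_zpow_right₀ hN1 ?_) (by positivity)
      omega
    have hconv : |subsetConv
        (fun A => cumulantOn (insert j A) (fun A => edgeMoment θ N (A.biUnion E)))
        (fun A => cumulantOn (insert k A) (fun A => edgeMoment θ N (A.biUnion E))) U| ≤
        2 ^ n * (C * C * (N : ℝ) ^ (1 - (t : ℤ))) := by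
      refine (Finset.abs_sum_le_sum_abs _ _).trans
        ((Finset.sum_le_card_nsmul _ _ _ hterm).trans ?_)
      rw [card_powerset, nsmul_eq_mul]
      push_cast
      gcongr
      · norm_num
      · omega
    rw [← sub_eq_iff_eq_add] at hmerge
    rw [← hmerge]
    refine (abs_sub _ _).trans ((add_le_add hmerged hconv).trans ?_)
    have : 0 ≤ D * (N : ℝ) ^ (1 - (t : ℤ)) := by positivity
    linarith

end EdgeMoments

lemma ewensE_prod_Bis {ι : Type*} [DecidableEq ι] (θ : ℝ) {N : ℕ} (i s : ι → Fin N)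
    (A : Finset ι) :
    ewensE θ N (fun σ => ∏ j ∈ A, Bis (i j) (s j) σ) =
      edgeMoment θ N (A.biUnion fun j => {(i j, s j)}) := by
  rw [edgeMoment]
  congr 1
  funext σ
  simp only [Bis, Finset.prod_ite_zero, prod_const_one, mem_biUnion, mem_singleton]
  refine if_congr ⟨?_, fun h j hj => h _ ⟨j, hj, rfl⟩⟩ rfl rfl
  rintro h _ ⟨j, hj, rfl⟩
  exact h j hj

lemma verts_biUnion_singleton {V ι : Type*} [DecidableEq V] [DecidableEq ι] (i s : ι → V)
    (A : Finset ι) : verts (A.biUnion fun j => {(i j, s j)}) = A.image i ∪ A.image s := by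
  rw [biUnion_singleton, verts, image_image, image_image]
  rfl

/-- Proposition 5.2: for an Ewens(θ) random permutation,
`|κ(B_{i_1,s_1},…,B_{i_ℓ,s_ℓ})| ≤ C_ℓ · N^{−t+1}` where `t` is the number of distinct
values among all the `i_j` and `s_j`. -/
theorem cumulant_elementary_bound (θ : ℝ) (hθ : 0 < θ) (ℓ : ℕ) (hℓ : 1 ≤ ℓ) :
    ∃ C : ℝ, ∀ N : ℕ, 1 ≤ N → ∀ i s : Fin ℓ → Fin N,
      |cumulantOn (Finset.univ : Finset (Fin ℓ))
          (fun Δ => ewensE θ N (fun σ => ∏ j ∈ Δ, Bis (i j) (s j) σ))|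
        ≤ C * (N : ℝ) ^
            (1 - ((Finset.univ.image i ∪ Finset.univ.image s).card : ℤ)) := by
  obtain ⟨C, _, hC⟩ := exists_cumulantOn_edgeMoment_le (ι := Fin ℓ) hθ ℓ ℓ
  refine ⟨C, fun N hN i s => ?_⟩
  have h := hC N hN univ ⟨⟨0, hℓ⟩, mem_univ _⟩ (by simp) (fun j => {(i j, s j)})
    (fun j _ => edgeConnected_singleton _)
    (card_biUnion_le.trans (by simp))
  rw [verts_biUnion_singleton] at h
  simpa only [ewensE_prod_Bis] using h

end
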